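/- Let V_h be a finite-dimensional subspace of a Hilbert space V, A and A_h bounded bilinear forms on V and V_h respectively with A_h coercive on V_h with constant α > 0, K ⊂ V and K_h ⊂ V_h closed convex sets, f ∈ V'. Let u ∈ K solve A(u, u-v) ≤ ⟨f, u-v⟩ for all v ∈ K, and u_h ∈ K_h solve A_h(u_h, u_h - v_h) ≤ ⟨f, u_h - v_h⟩ for all v_h ∈ K_h. Then for every v_h ∈ K_h, α‖v_h - u_h‖² ≤ (A - A_h)(v_h, u_h - v_h) + M‖u - v_h‖‖u_h - v_h‖ + ⟨Λ, v_h - u_h⟩, where Λ ∈ V' is defined by ⟨Λ, w⟩ = A(u, w) - ⟨f, w⟩ and M is the continuity constant of A. -/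

import Mathlib

/-- Strang-type error decomposition for variational inequalities with a perturbed bilinear
form: if `u ∈ K` solves the continuous variational inequality and `u_h ∈ K_h ⊆ V_h` solves
the discrete one for the perturbed form `A_h` (coercive on `V_h` with constant `α`), then
for every `v_h ∈ K_h`,
`α‖v_h - u_h‖² ≤ (A - A_h)(v_h, u_h - v_h) + M‖u - v_h‖‖u_h - v_h‖ + ⟨Λ, v_h - u_h⟩`
with `⟨Λ, w⟩ = A(u,w) - ⟨f,w⟩`. -/
theorem stmt_13 {V : Type*} [NormedAddCommGroup V] [InnerProductSpace ℝ V] [CompleteSpace V]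
    (Vh : Submodule ℝ V) (hVh : FiniteDimensional ℝ Vh)
    (A Ah : V →L[ℝ] V →L[ℝ] ℝ)
    (α : ℝ) (hα : 0 < α) (hcoer : ∀ wh ∈ Vh, α * ‖wh‖ ^ 2 ≤ Ah wh wh)
    (M : ℝ) (hM : ∀ v w : V, |A v w| ≤ M * ‖v‖ * ‖w‖)
    (K : Set V) (hKcl : IsClosed K) (hKcx : Convex ℝ K)
    (Kh : Set V) (hKh : Kh ⊆ (Vh : Set V)) (hKhcl : IsClosed Kh) (hKhcx : Convex ℝ Kh)
    (f : V →L[ℝ] ℝ)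
    (u : V) (hu : u ∈ K) (hVI : ∀ v ∈ K, A u (u - v) ≤ f (u - v))
    (uh : V) (huh : uh ∈ Kh) (hVIh : ∀ vh ∈ Kh, Ah uh (uh - vh) ≤ f (uh - vh)) :
    ∀ vh ∈ Kh, α * ‖vh - uh‖ ^ 2 ≤
      (A vh (uh - vh) - Ah vh (uh - vh)) + M * ‖u - vh‖ * ‖uh - vh‖ +
        (A u (vh - uh) - f (vh - uh)) := by
  intro vh hvh
  have hc := hcoer (vh - uh) (Vh.sub_mem (hKh hvh) (hKh huh))
  have hd := hVIh vh hvh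
  have hb := (abs_le.mp (hM (u - vh) (uh - vh))).2
  simp only [map_sub, sub_apply] at hc hd hb ⊢
  linarith
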